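/- arXiv:1811.09210 — 2 statements merged into one kernel-verified Lean document; each statement's English description precedes it below -/
import Mathlib

section
/- Let D be a PvMD and let I be a t-ideal of D (I^t = I, I nonzero). Then I is t-idempotent if and only if I is a radical ideal and every prime ideal of D minimal over I is t-idempotent. -/
/-! Statement 13: Let D be a PvMD and I a nonzero t-ideal. Then I is t-idempotent iff I is a radical ideal and every prime minimal over I is t-idempotent. -/

noncomputable section

/-- The image of an ideal of `D` in the fraction field of `D`, as a `D`-submodule. -/
def coeI (D : Type*) [CommRing D] [IsDomain D] (I : Ideal D) :
    Submodule D (FractionRing D) :=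
  Submodule.map (Algebra.linearMap D (FractionRing D)) I

/-- The `v`-operation on `D`-submodules of the fraction field `K`:
`E^v = (E⁻¹)⁻¹`, where `E⁻¹ = (D : E) = {x ∈ K : xE ⊆ D}`. -/
def vSub (D : Type*) [CommRing D] [IsDomain D] (E : Submodule D (FractionRing D)) :
    Submodule D (FractionRing D) :=
  1 / (1 / E)

/-- The `t`-operation: `E^t = ⋃ {F^v : F` a nonzero finitely generated submodule `⊆ E}`,
as a subset of the fraction field. -/
def tSet (D : Type*) [CommRing D] [IsDomain D] (E : Submodule D (FractionRing D)) :
    Set (FractionRing D) :=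
  ⋃ F ∈ {F : Submodule D (FractionRing D) | F.FG ∧ F ≠ ⊥ ∧ F ≤ E},
    (vSub D F : Set (FractionRing D))

/-- An integral ideal `I` of `D` is a `t`-ideal if `I^t = I`. -/
def IsTIdeal (D : Type*) [CommRing D] [IsDomain D] (I : Ideal D) : Prop :=
  tSet D (coeI D I) = (coeI D I : Set (FractionRing D))

/-- A nonzero ideal `I` of `D` is `t`-idempotent if `(I²)^t = I^t`. -/
def TIdem (D : Type*) [CommRing D] [IsDomain D] (I : Ideal D) : Prop :=
  tSet D (coeI D (I * I)) = tSet D (coeI D I)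

/-- `D` is a Prüfer `v`-multiplication domain: `(F·F⁻¹)^t = D` for every nonzero
finitely generated ideal `F` of `D`. -/
def IsPvMD (D : Type*) [CommRing D] [IsDomain D] : Prop :=
  ∀ F : Ideal D, F ≠ ⊥ → F.FG →
    tSet D (coeI D F * (1 / coeI D F)) =
      ((1 : Submodule D (FractionRing D)) : Set (FractionRing D))

/-- A `t`-maximal ideal: an ideal maximal among proper integral `t`-ideals. -/
def IsTMax (D : Type*) [CommRing D] [IsDomain D] (M : Ideal D) : Prop :=
  M ≠ ⊤ ∧ IsTIdeal D M ∧ ∀ J : Ideal D, J ≠ ⊤ → IsTIdeal D J → M ≤ J → J = M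

/-- The localization `D_P` of `D` at a prime `P`, viewed as a subset of the fraction field:
the set of fractions `a / s` with `s ∉ P`. -/
def locSet (D : Type*) [CommRing D] [IsDomain D] (P : Ideal D) : Set (FractionRing D) :=
  {x | ∃ a s : D, s ∉ P ∧ x * algebraMap D (FractionRing D) s = algebraMap D (FractionRing D) a}

/-- A prime `t`-ideal `P` is `t`-sharp if `⋂ {D_M : M t-maximal, M ⊉ P} ⊄ D_P`. -/
def IsTSharp (D : Type*) [CommRing D] [IsDomain D] (P : Ideal D) : Prop :=
  ¬ (⋂ M ∈ {M : Ideal D | IsTMax D M ∧ ¬ P ≤ M}, locSet D M) ⊆ locSet D P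

/-- A prime ideal `P` of `D` is branched if there is a `P`-primary ideal distinct from `P`. -/
def IsBranched (D : Type*) [CommRing D] [IsDomain D] (P : Ideal D) : Prop :=
  ∃ Q : Ideal D, Q.IsPrimary ∧ Q.radical = P ∧ Q ≠ P

/-- `D` has finite `t`-character: every nonzero element lies in only finitely many
`t`-maximal ideals. -/
def FiniteTCharacter (D : Type*) [CommRing D] [IsDomain D] : Prop :=
  ∀ a : D, a ≠ 0 → {M : Ideal D | IsTMax D M ∧ a ∈ M}.Finite

/-- A nonzero ideal `I` of `D` is divisorial if `(I⁻¹)⁻¹ = I`. -/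
def IsDivisorial (D : Type*) [CommRing D] [IsDomain D] (I : Ideal D) : Prop :=
  vSub D (coeI D I) = coeI D I

section CommRing

variable {D : Type*} [CommRing D]

theorem algebraMap_mem_one (a : D) :
    algebraMap D (FractionRing D) a ∈ (1 : Submodule D (FractionRing D)) :=
  Submodule.mem_one.2 ⟨a, rfl⟩

theorem exists_fg_le_mul_self {A I : Ideal D} (hA : A.FG) (h : A ≤ I * I) :
    ∃ B : Ideal D, Submodule.FG B ∧ B ≤ I ∧ A ≤ B * B := by
  induction A, hA using Submodule.fg_induction with
  | singleton x =>
    have hx : x ∈ I * I := h (Submodule.mem_span_singleton_self x)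
    suffices ∃ B : Ideal D, Submodule.FG B ∧ B ≤ I ∧ x ∈ B * B by
      obtain ⟨B, h1, h2, h3⟩ := this
      exact ⟨B, h1, h2, (Ideal.span_singleton_le_iff_mem _).2 h3⟩
    induction hx using Submodule.mul_induction_on' with
    | mem_mul_mem y hy z hz =>
      refine ⟨Ideal.span {y} ⊔ Ideal.span {z},
        (Submodule.fg_span_singleton y).sup (Submodule.fg_span_singleton z),
        sup_le ((Ideal.span_singleton_le_iff_mem _).2 hy)
          ((Ideal.span_singleton_le_iff_mem _).2 hz),
        Ideal.mul_mem_mul (Ideal.mem_sup_left (Ideal.mem_span_singleton_self y))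
          (Ideal.mem_sup_right (Ideal.mem_span_singleton_self z))⟩
    | add x hx y hy ihx ihy =>
      obtain ⟨B, h1, h2, h3⟩ := ihx ((Ideal.span_singleton_le_iff_mem _).2 hx)
      obtain ⟨B', h1', h2', h3'⟩ := ihy ((Ideal.span_singleton_le_iff_mem _).2 hy)
      exact ⟨B ⊔ B', h1.sup h1', sup_le h2 h2', Ideal.add_mem _
        (Ideal.mul_mono le_sup_left le_sup_left h3)
        (Ideal.mul_mono le_sup_right le_sup_right h3')⟩
  | sup A A' _ _ hA hA' =>
    obtain ⟨B, h1, h2, h3⟩ := hA (le_sup_left.trans h)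
    obtain ⟨B', h1', h2', h3'⟩ := hA' (le_sup_right.trans h)
    exact ⟨B ⊔ B', h1.sup h1', sup_le h2 h2', sup_le
      (h3.trans (Ideal.mul_mono le_sup_left le_sup_left))
      (h3'.trans (Ideal.mul_mono le_sup_right le_sup_right))⟩

theorem exists_mem_of_mem_mul {B F : Ideal D} {z : FractionRing D}
    (hz : ∀ g ∈ F, z * algebraMap D (FractionRing D) g ∈ (1 : Submodule D (FractionRing D)))
    {t : D} (ht : t ∈ B * F) :
    ∃ b ∈ B, algebraMap D (FractionRing D) b = z * algebraMap D (FractionRing D) t := by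
  induction ht using Submodule.mul_induction_on' with
  | mem_mul_mem y hy g hg =>
    obtain ⟨r, hr⟩ := Submodule.mem_one.1 (hz g hg)
    refine ⟨y * r, B.mul_mem_right r hy, ?_⟩
    rw [map_mul, hr, map_mul]
    ring
  | add x _ y _ ihx ihy =>
    obtain ⟨b, hb, h⟩ := ihx
    obtain ⟨b', hb', h'⟩ := ihy
    exact ⟨b + b', B.add_mem hb hb', by rw [map_add, h, h', map_add, mul_add]⟩

/-- The contraction to `D` of the extension of `I` to the localization at `M`. -/
def locContraction (I M : Ideal D) [M.IsPrime] : Ideal D where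
  carrier := {x | ∃ s ∉ M, s * x ∈ I}
  zero_mem' := ⟨1, M.one_notMem, by simp⟩
  add_mem' := by
    rintro x y ⟨s, hs, hx⟩ ⟨t, ht, hy⟩
    refine ⟨s * t, fun h => (‹M.IsPrime›.mem_or_mem h).elim hs ht, ?_⟩
    rw [show s * t * (x + y) = t * (s * x) + s * (t * y) by ring]
    exact I.add_mem (I.mul_mem_left _ hx) (I.mul_mem_left _ hy)
  smul_mem' := by
    rintro c x ⟨s, hs, hx⟩
    refine ⟨s, hs, ?_⟩
    rw [smul_eq_mul, mul_left_comm]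
    exact I.mul_mem_left c hx

theorem locContraction_mul_self_le {I M : Ideal D} [M.IsPrime] :
    locContraction I M * locContraction I M ≤ locContraction (I * I) M := by
  refine Ideal.mul_le.2 ?_
  rintro x ⟨s, hs, hx⟩ y ⟨s', hs', hy⟩
  refine ⟨s * s', fun h => (‹M.IsPrime›.mem_or_mem h).elim hs hs', ?_⟩
  rw [mul_mul_mul_comm]
  exact Ideal.mul_mem_mul hx hy

end CommRing

/-- A finitely generated ideal `J` of `D` with `J⁻¹ ⊆ D`. -/
def IsGV (D : Type*) [CommRing D] [IsDomain D] (J : Ideal D) : Prop :=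
  J.FG ∧ ∀ x : FractionRing D,
    (∀ j ∈ J, x * algebraMap D (FractionRing D) j ∈ (1 : Submodule D (FractionRing D))) →
      x ∈ (1 : Submodule D (FractionRing D))

section wClosure

variable {D : Type*} [CommRing D] [IsDomain D]

theorem isGV_top : IsGV D ⊤ :=
  ⟨Ideal.fg_top D, fun x h => by simpa using h 1 trivial⟩

theorem IsGV.mul {J J' : Ideal D} (h : IsGV D J) (h' : IsGV D J') : IsGV D (J * J') := by
  refine ⟨h.1.mul h'.1, fun x hx => h.2 x fun j hj => h'.2 _ fun j' hj' => ?_⟩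
  have := hx (j * j') (Ideal.mul_mem_mul hj hj')
  rwa [map_mul, ← mul_assoc] at this

/-- The `w`-closure of an integral ideal: all `a` with `a J ⊆ E` for some `J` as in `IsGV`. -/
def wClosure (E : Ideal D) : Ideal D where
  carrier := {a | ∃ J, IsGV D J ∧ ∀ j ∈ J, a * j ∈ E}
  zero_mem' := ⟨⊤, isGV_top, fun j _ => (zero_mul j).symm ▸ E.zero_mem⟩
  add_mem' := by
    rintro a b ⟨J, hJ, ha⟩ ⟨J', hJ', hb⟩
    refine ⟨J * J', hJ.mul hJ', fun j hj => ?_⟩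
    rw [add_mul]
    have hj1 : j ∈ J := Ideal.mul_le_left hj
    have hj2 : j ∈ J' := Ideal.mul_le_right hj
    exact E.add_mem (ha j hj1) (hb j hj2)
  smul_mem' := by
    rintro c a ⟨J, hJ, ha⟩
    refine ⟨J, hJ, fun j hj => ?_⟩
    rw [smul_eq_mul, mul_assoc]
    exact E.mul_mem_left c (ha j hj)

theorem le_wClosure (E : Ideal D) : E ≤ wClosure E := fun _ ha =>
  ⟨⊤, isGV_top, fun j _ => E.mul_mem_right j ha⟩

theorem wClosure_mono {E E' : Ideal D} (h : E ≤ E') : wClosure E ≤ wClosure E' :=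
  fun _ ⟨J, hJ, ha⟩ => ⟨J, hJ, fun j hj => h (ha j hj)⟩

theorem exists_isGV_mul_le {A E : Ideal D} (hA : A.FG) (h : A ≤ wClosure E) :
    ∃ J, IsGV D J ∧ A * J ≤ E := by
  induction A, hA using Submodule.fg_induction with
  | singleton x =>
    obtain ⟨J, hJ, hx⟩ := h (Submodule.mem_span_singleton_self x)
    refine ⟨J, hJ, Ideal.mul_le.2 fun y hy j hj => ?_⟩
    obtain ⟨r, rfl⟩ := Ideal.mem_span_singleton'.1 hy
    rw [mul_assoc]
    exact E.mul_mem_left r (hx j hj)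
  | sup A B _ _ hA hB =>
    obtain ⟨J, hJ, h1⟩ := hA (le_sup_left.trans h)
    obtain ⟨J', hJ', h2⟩ := hB (le_sup_right.trans h)
    refine ⟨J * J', hJ.mul hJ', ?_⟩
    rw [Ideal.sup_mul]
    exact sup_le ((Ideal.mul_mono_right Ideal.mul_le_left).trans h1)
      ((Ideal.mul_mono_right Ideal.mul_le_right).trans h2)

theorem mem_wClosure_of_isGV {E J : Ideal D} (hJ : IsGV D J) {a : D}
    (h : ∀ j ∈ J, a * j ∈ wClosure E) : a ∈ wClosure E := by
  have hle : Ideal.span {a} * J ≤ wClosure E := by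
    refine Ideal.mul_le.2 fun y hy j hj => ?_
    obtain ⟨r, rfl⟩ := Ideal.mem_span_singleton'.1 hy
    rw [mul_assoc]
    exact Ideal.mul_mem_left _ r (h j hj)
  obtain ⟨J', hJ', h'⟩ := exists_isGV_mul_le ((Submodule.fg_span_singleton a).mul hJ.1) hle
  refine ⟨J * J', hJ.mul hJ', fun j hj => h' ?_⟩
  rw [mul_assoc]
  exact Ideal.mul_mem_mul (Ideal.mem_span_singleton_self a) hj

theorem wClosure_le_wClosure {E E' : Ideal D} (h : E ≤ wClosure E') :
    wClosure E ≤ wClosure E' := fun _ ⟨_, hJ, ha⟩ =>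
  mem_wClosure_of_isGV hJ fun j hj => h (ha j hj)

theorem mem_coeI {E : Ideal D} {x : FractionRing D} :
    x ∈ coeI D E ↔ ∃ a ∈ E, algebraMap D (FractionRing D) a = x := by
  simp [coeI]

theorem algebraMap_mem_coeI {E : Ideal D} {a : D} :
    algebraMap D (FractionRing D) a ∈ coeI D E ↔ a ∈ E := by
  rw [mem_coeI]
  refine ⟨?_, fun h => ⟨a, h, rfl⟩⟩
  rintro ⟨b, hb, h⟩
  rwa [← IsFractionRing.injective D (FractionRing D) h]

theorem mem_vSub {E : Submodule D (FractionRing D)} {x : FractionRing D} :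
    x ∈ vSub D E ↔ ∀ z, (∀ y ∈ E, z * y ∈ (1 : Submodule D (FractionRing D))) →
      x * z ∈ (1 : Submodule D (FractionRing D)) := by
  simp only [vSub, Submodule.mem_div_iff_forall_mul_mem]

theorem mem_tSet {E : Submodule D (FractionRing D)} {x : FractionRing D} :
    x ∈ tSet D E ↔ ∃ F : Submodule D (FractionRing D),
      F.FG ∧ F ≠ ⊥ ∧ F ≤ E ∧ x ∈ vSub D F := by
  simp [tSet, and_assoc]

/-- Every submodule of the fraction field contained in an integral ideal is an integral ideal. -/
theorem exists_eq_coeI {F : Submodule D (FractionRing D)} {E : Ideal D} (hF : F.FG)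
    (h : F ≤ coeI D E) : ∃ A : Ideal D, A.FG ∧ A ≤ E ∧ F = coeI D A := by
  have hA : coeI D (F.comap (Algebra.linearMap D (FractionRing D))) = F := by
    refine Submodule.map_comap_eq_of_le fun x hx => ?_
    obtain ⟨a, -, rfl⟩ := mem_coeI.1 (h hx)
    exact ⟨a, rfl⟩
  refine ⟨F.comap (Algebra.linearMap D (FractionRing D)), ?_, fun a ha => ?_, hA.symm⟩
  · refine Submodule.fg_of_fg_map_injective (Algebra.linearMap D (FractionRing D))
      (IsFractionRing.injective D (FractionRing D)) ?_
    rwa [← hA] at hF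
  · exact algebraMap_mem_coeI.1 (h ha)

theorem one_eq_coeI_top : (1 : Submodule D (FractionRing D)) = coeI D ⊤ := by
  rw [coeI, Submodule.map_top, Submodule.one_eq_range]

theorem IsPvMD.exists_isGV_le (hD : IsPvMD D) {F : Ideal D} (hF0 : F ≠ ⊥) (hF : F.FG) :
    ∃ J, IsGV D J ∧ ∀ T : Ideal D,
      (∀ f ∈ F, ∀ z : FractionRing D,
        (∀ g ∈ F, z * algebraMap D (FractionRing D) g ∈ (1 : Submodule D (FractionRing D))) →
        ∀ d, algebraMap D (FractionRing D) d = z * algebraMap D (FractionRing D) f → d ∈ T) →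
      J ≤ T := by
  have h1 : (1 : FractionRing D) ∈ tSet D (coeI D F * (1 / coeI D F)) := by
    rw [hD F hF0 hF]
    exact Submodule.mem_one.2 ⟨1, map_one _⟩
  obtain ⟨G, hG, -, hle, hv⟩ := mem_tSet.1 h1
  have hone : coeI D F * (1 / coeI D F) ≤ coeI D ⊤ := by
    rw [← one_eq_coeI_top]
    exact Submodule.mul_one_div_le_one
  obtain ⟨J, hJ, -, rfl⟩ := exists_eq_coeI hG (hle.trans hone)
  refine ⟨J, ⟨hJ, fun x hx => ?_⟩, fun T hT => ?_⟩
  · have := mem_vSub.1 hv x fun y hy => by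
      obtain ⟨j, hj, rfl⟩ := mem_coeI.1 hy
      exact hx j hj
    rwa [one_mul] at this
  · have hle' : coeI D F * (1 / coeI D F) ≤ coeI D T := by
      refine Submodule.mul_le.2 fun m hm z hz => ?_
      obtain ⟨f, hf, rfl⟩ := mem_coeI.1 hm
      rw [Submodule.mem_div_iff_forall_mul_mem] at hz
      obtain ⟨d, hd⟩ := Submodule.mem_one.1 (hz _ (algebraMap_mem_coeI.2 hf))
      rw [mul_comm, ← hd, algebraMap_mem_coeI]
      exact hT f hf z (fun g hg => hz _ (algebraMap_mem_coeI.2 hg)) d hd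
    exact fun j hj => algebraMap_mem_coeI.1 (hle' (hle (algebraMap_mem_coeI.2 hj)))

/-- In a PvMD the `t`-closure of a nonzero integral ideal is its `w`-closure. -/
theorem IsPvMD.tSet_coeI (hD : IsPvMD D) {E : Ideal D} (hE : E ≠ ⊥) :
    tSet D (coeI D E) = coeI D (wClosure E) := by
  ext x
  rw [mem_tSet, SetLike.mem_coe, mem_coeI]
  constructor
  · rintro ⟨F, hF, hF0, hFE, hx⟩
    obtain ⟨A, hA, hAE, rfl⟩ := exists_eq_coeI hF hFE
    have hA0 : A ≠ ⊥ := by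
      rintro rfl
      exact hF0 (Submodule.map_bot _)
    obtain ⟨J, hJ, hJT⟩ := hD.exists_isGV_le hA0 hA
    have key : ∀ j ∈ J, x * algebraMap D (FractionRing D) j ∈ coeI D A := by
      have := hJT ((coeI D A).comap (LinearMap.toSpanSingleton D (FractionRing D) x)) ?_
      · intro j hj
        have hj' := this hj
        rwa [Submodule.mem_comap, LinearMap.toSpanSingleton_apply, Algebra.smul_def,
          mul_comm] at hj'
      · intro f hf z hz d hd
        obtain ⟨r, hr⟩ := Submodule.mem_one.1 (mem_vSub.1 hx z fun y hy => by
          obtain ⟨g, hg, rfl⟩ := mem_coeI.1 hy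
          exact hz g hg)
        rw [Submodule.mem_comap, LinearMap.toSpanSingleton_apply, Algebra.smul_def, hd,
          mul_right_comm, mul_comm z x, ← hr, ← map_mul]
        exact algebraMap_mem_coeI.2 (A.mul_mem_left r hf)
    obtain ⟨a, rfl⟩ := Submodule.mem_one.1 (hJ.2 x fun j hj => by
      obtain ⟨b, -, hb⟩ := mem_coeI.1 (key j hj)
      exact hb ▸ algebraMap_mem_one b)
    refine ⟨a, ⟨J, hJ, fun j hj => hAE ?_⟩, rfl⟩
    rw [← algebraMap_mem_coeI, map_mul]
    exact key j hj
  · rintro ⟨a, ⟨J, hJ, ha⟩, rfl⟩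
    obtain ⟨e, he, he0⟩ := Submodule.exists_mem_ne_zero_of_ne_bot hE
    refine ⟨coeI D (Ideal.span {a} * J ⊔ Ideal.span {e}), ?_, ?_, Submodule.map_mono ?_, ?_⟩
    · exact (((Submodule.fg_span_singleton a).mul hJ.1).sup
        (Submodule.fg_span_singleton e)).map _
    · refine (Submodule.ne_bot_iff _).2 ⟨algebraMap D (FractionRing D) e, ?_, ?_⟩
      · exact algebraMap_mem_coeI.2 (Ideal.mem_sup_right (Ideal.mem_span_singleton_self e))
      · rwa [Ne, IsFractionRing.to_map_eq_zero_iff]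
    · refine sup_le (Ideal.mul_le.2 fun y hy j hj => ?_)
        ((Ideal.span_singleton_le_iff_mem _).2 he)
      obtain ⟨r, rfl⟩ := Ideal.mem_span_singleton'.1 hy
      rw [mul_assoc]
      exact E.mul_mem_left r (ha j hj)
    · refine mem_vSub.2 fun z hz => hJ.2 _ fun j hj => ?_
      have := hz (algebraMap D (FractionRing D) (a * j)) (algebraMap_mem_coeI.2
        (Ideal.mem_sup_left (Ideal.mul_mem_mul (Ideal.mem_span_singleton_self a) hj)))
      rwa [map_mul, ← mul_assoc, mul_comm z] at this

theorem coeI_injective : Function.Injective (coeI D) :=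
  Submodule.map_injective_of_injective (IsFractionRing.injective D (FractionRing D))

theorem IsPvMD.isTIdeal_iff (hD : IsPvMD D) {E : Ideal D} (hE : E ≠ ⊥) :
    IsTIdeal D E ↔ wClosure E = E := by
  rw [IsTIdeal, hD.tSet_coeI hE, SetLike.coe_set_eq, coeI_injective.eq_iff]

theorem IsPvMD.tIdem_iff (hD : IsPvMD D) {E : Ideal D} (hE : E ≠ ⊥) :
    TIdem D E ↔ E ≤ wClosure (E * E) := by
  rw [TIdem, hD.tSet_coeI hE, hD.tSet_coeI (mul_ne_zero hE hE), SetLike.coe_set_eq,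
    coeI_injective.eq_iff]
  exact ⟨fun h => h ▸ le_wClosure E,
    fun h => le_antisymm (wClosure_mono Ideal.mul_le_left) (wClosure_le_wClosure h)⟩

theorem IsPvMD.mem_wClosure_of_sq_mem (hD : IsPvMD D) {B : Ideal D} (hB : Submodule.FG B) {a : D}
    (h : a * a ∈ wClosure (B * B)) : a ∈ wClosure B := by
  rcases eq_or_ne a 0 with rfl | ha
  · exact Ideal.zero_mem _
  obtain ⟨J, hJ, haJ⟩ := h
  have haF : a ∈ B ⊔ Ideal.span {a} := Ideal.mem_sup_right (Ideal.mem_span_singleton_self a)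
  obtain ⟨J', hJ', hT⟩ := hD.exists_isGV_le
    ((Submodule.ne_bot_iff _).2 ⟨a, haF, ha⟩) (hB.sup (Submodule.fg_span_singleton a))
  refine mem_wClosure_of_isGV hJ' fun j' hj' => ?_
  refine hT (Submodule.comap (LinearMap.mulLeft D a) (wClosure B)) (fun f hf z hz d hd => ?_) hj'
  refine ⟨J, hJ, fun j hj => ?_⟩
  have hmem : a * j * f ∈ B * (B ⊔ Ideal.span {a}) := by
    obtain ⟨b, hb, c, hc, rfl⟩ := Submodule.mem_sup.1 hf
    obtain ⟨r, rfl⟩ := Ideal.mem_span_singleton'.1 hc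
    rw [mul_add]
    refine Ideal.add_mem _ ?_ ?_
    · rw [mul_comm (a * j)]
      exact Ideal.mul_mem_mul hb (Ideal.mul_mem_right _ _ haF)
    · have := Ideal.mul_mem_left _ r (haJ j hj)
      rw [show a * j * (r * a) = r * (a * a * j) by ring]
      exact Ideal.mul_mono_right le_sup_left this
  obtain ⟨b, hb, hb'⟩ := exists_mem_of_mem_mul hz hmem
  convert hb using 1
  apply IsFractionRing.injective D (FractionRing D)
  rw [hb', LinearMap.mulLeft_apply, map_mul, map_mul, hd, map_mul, map_mul]
  ring

theorem IsPvMD.isRadical_of_le (hD : IsPvMD D) {I : Ideal D} (hI : wClosure I = I)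
    (h : I ≤ wClosure (I * I)) : I.IsRadical := by
  refine (Ideal.isRadical_iff_pow_one_lt 2 one_lt_two).2 fun a ha => ?_
  obtain ⟨J, hJ, haJ⟩ := h ha
  have hle : Ideal.span {a ^ 2} * J ≤ I * I := by
    refine Ideal.mul_le.2 fun y hy j hj => ?_
    obtain ⟨r, rfl⟩ := Ideal.mem_span_singleton'.1 hy
    rw [mul_assoc]
    exact Ideal.mul_mem_left _ r (haJ j hj)
  obtain ⟨B, hB, hBI, hAB⟩ :=
    exists_fg_le_mul_self ((Submodule.fg_span_singleton (a ^ 2)).mul hJ.1) hle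
  rw [← hI]
  refine wClosure_mono hBI (hD.mem_wClosure_of_sq_mem hB ⟨J, hJ, fun j hj => hAB ?_⟩)
  rw [← sq]
  exact Ideal.mul_mem_mul (Ideal.mem_span_singleton_self _) hj

theorem IsPvMD.le_wClosure_of_mem_minimalPrimes (hD : IsPvMD D) {I P : Ideal D}
    (hI : I.IsRadical) (h : I ≤ wClosure (I * I)) (hP : P ∈ I.minimalPrimes) :
    P ≤ wClosure (P * P) := by
  intro a ha
  have : P.IsPrime := hP.1.1
  obtain ⟨s, hs, hsa⟩ : ∃ s ∉ P, s * a ∈ I := by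
    by_contra! hcon
    obtain ⟨p, hp, hIp, hdisj⟩ := Ideal.exists_le_prime_disjoint I
      (P.primeCompl ⊔ Submonoid.powers a) (Set.disjoint_right.2 fun x hx hxI => by
        obtain ⟨s, hs, _, ⟨n, rfl⟩, rfl⟩ := Submonoid.mem_sup.1 hx
        refine hcon s hs (hI ⟨n + 1, ?_⟩)
        rw [show (s * a) ^ (n + 1) = s ^ n * a * (s * a ^ n) by ring]
        exact I.mul_mem_left _ hxI)
    have hpP : p ≤ P := fun x hx => by
      by_contra hxP
      exact Set.disjoint_left.1 hdisj hx (Submonoid.mem_sup_left hxP)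
    exact Set.disjoint_left.1 hdisj (hP.2 ⟨hp, hIp⟩ hpP ha)
      (Submonoid.mem_sup_right (Submonoid.mem_powers a))
  have hs0 : s ≠ 0 := fun h0 => hs (h0 ▸ P.zero_mem)
  have hsF : s ∈ Ideal.span {a} ⊔ Ideal.span {s} :=
    Ideal.mem_sup_right (Ideal.mem_span_singleton_self s)
  have haF : a ∈ Ideal.span {a} ⊔ Ideal.span {s} :=
    Ideal.mem_sup_left (Ideal.mem_span_singleton_self a)
  obtain ⟨J, hJ, hT⟩ := hD.exists_isGV_le ((Submodule.ne_bot_iff _).2 ⟨s, hsF, hs0⟩)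
    ((Submodule.fg_span_singleton a).sup (Submodule.fg_span_singleton s))
  refine mem_wClosure_of_isGV hJ fun j hj => ?_
  refine hT (Submodule.comap (LinearMap.mulLeft D a) (wClosure (P * P))) (fun f hf z hz d hd => ?_) hj
  obtain ⟨x, hx⟩ := Submodule.mem_one.1 (hz a haF)
  obtain ⟨y, hy⟩ := Submodule.mem_one.1 (hz s hsF)
  have hxy : s * x = a * y := by
    apply IsFractionRing.injective D (FractionRing D)
    rw [map_mul, map_mul, hx, hy]
    ring
  have hxP : x ∈ P := (this.mem_or_mem (hxy ▸ P.mul_mem_right y ha)).resolve_left hs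
  have hax : a * x ∈ wClosure (P * P) := le_wClosure _ (Ideal.mul_mem_mul ha hxP)
  have hay : a * y ∈ wClosure (P * P) := by
    refine wClosure_mono (Ideal.mul_mono hP.1.2 hP.1.2) (h (hI ⟨2, ?_⟩))
    rw [show (a * y) ^ 2 = x * y * (s * a) by linear_combination -(a * y) * hxy]
    exact I.mul_mem_left _ hsa
  obtain ⟨b, hb, c, hc, rfl⟩ := Submodule.mem_sup.1 hf
  obtain ⟨r, rfl⟩ := Ideal.mem_span_singleton'.1 hb
  obtain ⟨r', rfl⟩ := Ideal.mem_span_singleton'.1 hc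
  have hd' : d = r * x + r' * y := by
    apply IsFractionRing.injective D (FractionRing D)
    rw [hd]
    simp only [map_add, map_mul, hx, hy]
    ring
  rw [Submodule.mem_comap, LinearMap.mulLeft_apply, hd',
    show a * (r * x + r' * y) = r * (a * x) + r' * (a * y) by ring]
  exact Ideal.add_mem _ (Ideal.mul_mem_left _ r hax) (Ideal.mul_mem_left _ r' hay)

/-- An ideal containing no ideal as in `IsGV` lies in a prime ideal with the same property. -/
theorem exists_isPrime_forall_isGV_not_le {N : Ideal D} (hN : ∀ J, IsGV D J → ¬ J ≤ N) :
    ∃ M : Ideal D, M.IsPrime ∧ N ≤ M ∧ ∀ J, IsGV D J → ¬ J ≤ M := by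
  obtain ⟨M, hNM, hM⟩ := zorn_le_nonempty₀ {M : Ideal D | ∀ J, IsGV D J → ¬ J ≤ M}
    (fun c hc hchain p hp => by
      refine ⟨sSup c, fun J hJ hle => ?_, fun q hq => le_sSup hq⟩
      obtain ⟨q, hq, hJq⟩ := (CompleteLattice.isCompactElement_iff_le_of_directed_sSup_le _ J).1
        ((Submodule.fg_iff_compact J).1 hJ.1) c ⟨p, hp⟩ hchain.directedOn hle
      exact hc hq J hJ hJq) N hN
  have hGV : ∀ x ∉ M, ∃ J, IsGV D J ∧ J ≤ M ⊔ Ideal.span {x} := by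
    intro x hx
    by_contra! hcon
    exact hx (hM.2 (y := M ⊔ Ideal.span {x}) hcon le_sup_left
      (Ideal.mem_sup_right (Ideal.mem_span_singleton_self x)))
  refine ⟨M, Ideal.isPrime_iff.2 ⟨fun h => hM.1 ⊤ isGV_top h.ge, fun {x y} hxy => ?_⟩, hNM, hM.1⟩
  by_contra! hcon
  obtain ⟨J, hJ, hJM⟩ := hGV x hcon.1
  obtain ⟨J', hJ', hJM'⟩ := hGV y hcon.2
  refine hM.1 _ (hJ.mul hJ') ((Ideal.mul_mono hJM hJM').trans ?_)
  rw [Ideal.sup_mul, Ideal.mul_sup M, Ideal.mul_sup, Ideal.span_singleton_mul_span_singleton]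
  exact sup_le (sup_le Ideal.mul_le_left Ideal.mul_le_left)
    (sup_le Ideal.mul_le_right ((Ideal.span_singleton_le_iff_mem _).2 hxy))

theorem IsPvMD.exists_mul_eq_mul (hD : IsPvMD D) {M : Ideal D}
    (hM : ∀ J, IsGV D J → ¬ J ≤ M) (x y : D) :
    ∃ u v, x * v = y * u ∧ (u ∉ M ∨ v ∉ M) := by
  by_cases h0 : Ideal.span {x} ⊔ Ideal.span {y} = (⊥ : Ideal D)
  · rw [sup_eq_bot_iff, Ideal.span_singleton_eq_bot, Ideal.span_singleton_eq_bot] at h0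
    refine ⟨1, 1, by rw [h0.1, h0.2], Or.inl fun h => ?_⟩
    exact hM ⊤ isGV_top ((Ideal.eq_top_iff_one M).2 h).ge
  obtain ⟨J, hJ, hT⟩ := hD.exists_isGV_le h0
    ((Submodule.fg_span_singleton x).sup (Submodule.fg_span_singleton y))
  by_contra! hcon
  refine hM J hJ (hT M fun f hf z hz d hd => ?_)
  obtain ⟨u, hu⟩ := Submodule.mem_one.1
    (hz x (Ideal.mem_sup_left (Ideal.mem_span_singleton_self x)))
  obtain ⟨v, hv⟩ := Submodule.mem_one.1
    (hz y (Ideal.mem_sup_right (Ideal.mem_span_singleton_self y)))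
  have huv : x * v = y * u := by
    apply IsFractionRing.injective D (FractionRing D)
    rw [map_mul, map_mul, hu, hv]
    ring
  obtain ⟨b, hb, c, hc, rfl⟩ := Submodule.mem_sup.1 hf
  obtain ⟨r, rfl⟩ := Ideal.mem_span_singleton'.1 hb
  obtain ⟨r', rfl⟩ := Ideal.mem_span_singleton'.1 hc
  have hd' : d = r * u + r' * v := by
    apply IsFractionRing.injective D (FractionRing D)
    rw [hd]
    simp only [map_add, map_mul, hu, hv]
    ring
  rw [hd']
  exact M.add_mem (M.mul_mem_left _ (hcon u v huv).1) (M.mul_mem_left _ (hcon u v huv).2)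

theorem IsPvMD.locContraction_mem_minimalPrimes (hD : IsPvMD D) {I M : Ideal D} [M.IsPrime]
    (hM : ∀ J, IsGV D J → ¬ J ≤ M) (hI : I.IsRadical) (hIM : I ≤ M) :
    locContraction I M ∈ I.minimalPrimes := by
  have hle : locContraction I M ≤ M := by
    rintro x ⟨s, hs, hx⟩
    exact (‹M.IsPrime›.mem_or_mem (hIM hx)).resolve_left hs
  have aux : ∀ s x y u v : D, s ∉ M → v ∉ M → s * (x * y) ∈ I → x * v = y * u →
      x ∈ locContraction I M := by
    intro s x y u v hs hv hxy huv
    refine ⟨s * v, fun h => (‹M.IsPrime›.mem_or_mem h).elim hs hv, hI ⟨2, ?_⟩⟩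
    rw [show (s * v * x) ^ 2 = s * v * u * (s * (x * y)) by
      linear_combination s ^ 2 * v * x * huv]
    exact I.mul_mem_left _ hxy
  refine ⟨⟨Ideal.isPrime_iff.2 ⟨fun h => ?_, fun {x y} hxy => ?_⟩, fun x hx => ?_⟩, ?_⟩
  · exact ‹M.IsPrime›.ne_top (top_le_iff.1 (h ▸ hle))
  · obtain ⟨s, hs, hxy⟩ := hxy
    obtain ⟨u, v, huv, h | h⟩ := hD.exists_mul_eq_mul hM x y
    · exact Or.inr (aux s y x v u hs h (by rwa [mul_comm y]) huv.symm)
    · exact Or.inl (aux s x y u v hs h hxy huv)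
  · exact ⟨1, M.one_notMem, by rwa [one_mul]⟩
  · rintro P ⟨hP, hIP⟩ hPle x ⟨s, hs, hx⟩
    exact (hP.mem_or_mem (hIP hx)).resolve_left fun h => hs (hle (hPle h))

theorem IsPvMD.le_wClosure_of_forall_minimalPrimes (hD : IsPvMD D) {I : Ideal D}
    (hI : I.IsRadical) (h : ∀ P ∈ I.minimalPrimes, P ≤ wClosure (P * P)) :
    I ≤ wClosure (I * I) := by
  intro a ha
  by_contra hcon
  obtain ⟨M, hMp, hNM, hM⟩ := exists_isPrime_forall_isGV_not_le
    (N := Submodule.comap (LinearMap.mulLeft D a) (wClosure (I * I)))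
    fun J hJ hle => hcon (mem_wClosure_of_isGV hJ fun j hj => hle hj)
  have hIM : I ≤ M := fun b hb => hNM (le_wClosure _ (Ideal.mul_mem_mul ha hb))
  have hQ := hD.locContraction_mem_minimalPrimes hM hI hIM
  obtain ⟨J, hJ, haJ⟩ := h _ hQ (hQ.1.2 ha)
  obtain ⟨j, hj, hjM⟩ := SetLike.not_le_iff_exists.1 (hM J hJ)
  obtain ⟨s, hs, hsj⟩ := locContraction_mul_self_le (haJ j hj)
  refine (hMp.mem_or_mem (hNM (le_wClosure _ ?_) : s * j ∈ M)).elim hs hjM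
  rwa [LinearMap.mulLeft_apply, mul_left_comm]

end wClosure

theorem statement13 (D : Type*) [CommRing D] [IsDomain D]
    (hPvMD : IsPvMD D)
    (I : Ideal D) (hI0 : I ≠ ⊥) (hIt : IsTIdeal D I) :
    TIdem D I ↔ I.radical = I ∧ ∀ P ∈ I.minimalPrimes, TIdem D P := by
  have hw := (hPvMD.isTIdeal_iff hI0).1 hIt
  have hne : ∀ P ∈ I.minimalPrimes, P ≠ ⊥ := fun P hP h0 =>
    hI0 (le_bot_iff.1 (h0 ▸ hP.1.2))
  rw [hPvMD.tIdem_iff hI0, Ideal.radical_eq_iff]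
  constructor
  · intro h
    have hrad := hPvMD.isRadical_of_le hw h
    exact ⟨hrad, fun P hP => (hPvMD.tIdem_iff (hne P hP)).2
      (hPvMD.le_wClosure_of_mem_minimalPrimes hrad h hP)⟩
  · rintro ⟨hrad, h⟩
    exact hPvMD.le_wClosure_of_forall_minimalPrimes hrad fun P hP =>
      (hPvMD.tIdem_iff (hne P hP)).1 (h P hP)

end
end

section
/- Let D be a t-strongly discrete PvMD, i.e., a PvMD with no nonzero t-idempotent prime t-ideals. Then D has no t-proper t-idempotent ideals: if I is a nonzero ideal of D with (I²)^t = I^t, then I^t = D. -/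
/-! Statement 15: Let D be a t-strongly discrete PvMD (no nonzero t-idempotent prime t-ideals). If I is a nonzero ideal with (I²)^t = I^t, then I^t = D. -/

noncomputable section

section TClosure

variable {D : Type*} [CommRing D]

lemma le_one_div_iff {E G : Submodule D (FractionRing D)} : E ≤ 1 / G ↔ E * G ≤ 1 :=
  Submodule.le_div_iff_mul_le

/-- The nonzero finitely generated submodules of `E`. -/
def fgSubs (E : Submodule D (FractionRing D)) : Set (Submodule D (FractionRing D)) :=
  {F | F.FG ∧ F ≠ ⊥ ∧ F ≤ E}

lemma fgSubs_nonempty {E : Submodule D (FractionRing D)} (h : E ≠ ⊥) : (fgSubs E).Nonempty := by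
  obtain ⟨x, hx, hx0⟩ := Submodule.exists_mem_ne_zero_of_ne_bot h
  exact ⟨D ∙ x, Submodule.fg_span_singleton x, by simpa using hx0, by simpa using hx⟩

/-- The submodule `(E : α) ∩ D` of the fraction field. -/
def colonOne (E : Submodule D (FractionRing D)) (α : FractionRing D) :
    Submodule D (FractionRing D) :=
  1 ⊓ E.comap (LinearMap.mulLeft D α)

lemma mem_colonOne {E : Submodule D (FractionRing D)} {α x : FractionRing D} :
    x ∈ colonOne E α ↔ x ∈ (1 : Submodule D (FractionRing D)) ∧ α * x ∈ E := Iff.rfl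

lemma mul_mem_of_mem_one {E : Submodule D (FractionRing D)} {x y : FractionRing D}
    (hx : x ∈ (1 : Submodule D (FractionRing D))) (hy : y ∈ E) : x * y ∈ E := by
  simpa using Submodule.mul_mem_mul hx hy

lemma one_div_anti {E G : Submodule D (FractionRing D)} (h : E ≤ G) : 1 / G ≤ 1 / E :=
  le_one_div_iff.2 ((mul_le_mul_right h _).trans (le_one_div_iff.1 le_rfl))

lemma exists_fg_le_mul_self_s15 {E F : Submodule D (FractionRing D)} (hF : F.FG) (h : F ≤ E * E) :
    ∃ G : Submodule D (FractionRing D), G.FG ∧ G ≤ E ∧ F ≤ G * G := by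
  let S : Set (Submodule D (FractionRing D)) := (fun G => G * G) '' {G | G.FG ∧ G ≤ E}
  have hne : S.Nonempty := ⟨_, ⊥, ⟨Submodule.fg_bot, bot_le⟩, rfl⟩
  have hdir : DirectedOn (· ≤ ·) S := by
    rintro _ ⟨A, hA, rfl⟩ _ ⟨B, hB, rfl⟩
    exact ⟨_, ⟨A ⊔ B, ⟨hA.1.sup hB.1, sup_le hA.2 hB.2⟩, rfl⟩,
      mul_le_mul' le_sup_left le_sup_left, mul_le_mul' le_sup_right le_sup_right⟩
  have hle : E * E ≤ sSup S := by
    refine Submodule.mul_le.2 fun p hp q hq => ?_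
    refine (le_sSup ⟨Submodule.span D {p, q}, ⟨Submodule.fg_span (by simp), ?_⟩, rfl⟩ :
      Submodule.span D {p, q} * Submodule.span D {p, q} ≤ sSup S) ?_
    · rw [Submodule.span_le]
      rintro _ (rfl | rfl)
      exacts [hp, hq]
    · exact Submodule.mul_mem_mul (Submodule.subset_span (by simp))
        (Submodule.subset_span (by simp))
  obtain ⟨_, ⟨G, hG, rfl⟩, hFG⟩ := (CompleteLattice.isCompactElement_iff_le_of_directed_sSup_le
    _ F).1 ((Submodule.fg_iff_compact F).1 hF) _ hne hdir (h.trans hle)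
  exact ⟨G, hG.1, hG.2, hFG⟩

variable [IsDomain D]

lemma le_vSub (E : Submodule D (FractionRing D)) : E ≤ vSub D E := by
  rw [vSub, le_one_div_iff, mul_comm, ← le_one_div_iff]

lemma vSub_mono {E G : Submodule D (FractionRing D)} (h : E ≤ G) : vSub D E ≤ vSub D G :=
  one_div_anti (one_div_anti h)

lemma vSub_vSub_le (E : Submodule D (FractionRing D)) : vSub D (vSub D E) ≤ vSub D E :=
  one_div_anti (le_vSub (1 / E))

lemma vSub_le_one {E : Submodule D (FractionRing D)} (h : E ≤ 1) : vSub D E ≤ 1 := by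
  have h1 : (1 : Submodule D (FractionRing D)) ≤ 1 / E := le_one_div_iff.2 (by rwa [one_mul])
  calc vSub D E = vSub D E * 1 := (mul_one _).symm
    _ ≤ vSub D E * (1 / E) := mul_le_mul_right h1 _
    _ ≤ 1 := le_one_div_iff.1 le_rfl

lemma vSub_mul_vSub_le (E G : Submodule D (FractionRing D)) :
    vSub D E * vSub D G ≤ vSub D (E * G) := by
  have key (A : Submodule D (FractionRing D)) : vSub D A * (1 / A) ≤ 1 :=
    le_one_div_iff.1 le_rfl
  set U := 1 / (E * G) with hU
  have h0 : U * (E * G) ≤ 1 := le_one_div_iff.1 le_rfl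
  have h1 : U * G ≤ 1 / E := le_one_div_iff.2 (by rwa [mul_assoc, mul_comm G E])
  have h2 : vSub D E * U ≤ 1 / G := by
    refine le_one_div_iff.2 ?_
    rw [mul_assoc]
    exact (mul_le_mul_right h1 _).trans (key E)
  refine le_one_div_iff.2 ?_
  rw [← hU, mul_right_comm, mul_comm]
  exact (mul_le_mul_right h2 _).trans (key G)

lemma directedOn_vSub_fgSubs (E : Submodule D (FractionRing D)) :
    DirectedOn (· ≤ ·) (vSub D '' fgSubs E) := by
  rintro _ ⟨F, hF, rfl⟩ _ ⟨G, hG, rfl⟩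
  refine ⟨_, ⟨F ⊔ G, ⟨hF.1.sup hG.1, ?_, sup_le hF.2.2 hG.2.2⟩, rfl⟩,
    vSub_mono le_sup_left, vSub_mono le_sup_right⟩
  exact fun h => hF.2.1 (sup_eq_bot_iff.1 h).1

/-- The `t`-closure of a submodule of the fraction field, as a submodule. -/
def tSub (E : Submodule D (FractionRing D)) : Submodule D (FractionRing D) :=
  sSup (vSub D '' fgSubs E)

lemma mem_tSub {E : Submodule D (FractionRing D)} (h : E ≠ ⊥) {x : FractionRing D} :
    x ∈ tSub E ↔ ∃ F ∈ fgSubs E, x ∈ vSub D F := by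
  rw [tSub, Submodule.mem_sSup_of_directed ((fgSubs_nonempty h).image _)
    (directedOn_vSub_fgSubs E)]
  simp

lemma coe_tSub {E : Submodule D (FractionRing D)} (h : E ≠ ⊥) :
    (tSub E : Set (FractionRing D)) = tSet D E := by
  ext x
  simp [mem_tSub h, tSet, fgSubs]

lemma le_tSub (E : Submodule D (FractionRing D)) : E ≤ tSub E := by
  intro x hx
  rcases eq_or_ne x 0 with rfl | hx0
  · exact zero_mem _
  refine (le_sSup ⟨D ∙ x, ⟨Submodule.fg_span_singleton x, by simpa using hx0,
    by simpa using hx⟩, rfl⟩ : vSub D (D ∙ x) ≤ tSub E) ?_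
  exact le_vSub _ (Submodule.mem_span_singleton_self x)

lemma tSub_mono {E G : Submodule D (FractionRing D)} (h : E ≤ G) : tSub E ≤ tSub G :=
  sSup_le_sSup (Set.image_mono fun _ hF => ⟨hF.1, hF.2.1, hF.2.2.trans h⟩)

lemma tSub_tSub (E : Submodule D (FractionRing D)) : tSub (tSub E) = tSub E := by
  refine le_antisymm (sSup_le ?_) (le_tSub _)
  rintro _ ⟨F, ⟨hF, hF0, hFE⟩, rfl⟩
  have hE : E ≠ ⊥ := by
    rintro rfl
    refine hF0 (le_bot_iff.1 (hFE.trans (sSup_le ?_)))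
    rintro _ ⟨G, hG, rfl⟩
    exact absurd (le_bot_iff.1 hG.2.2) hG.2.1
  obtain ⟨_, ⟨G, hG, rfl⟩, hFG⟩ := (CompleteLattice.isCompactElement_iff_le_of_directed_sSup_le
    _ F).1 ((Submodule.fg_iff_compact F).1 hF) _ ((fgSubs_nonempty hE).image _)
    (directedOn_vSub_fgSubs E) hFE
  exact ((vSub_mono hFG).trans (vSub_vSub_le G)).trans (le_sSup ⟨G, hG, rfl⟩)

lemma tSub_le_iff {E G : Submodule D (FractionRing D)} : tSub E ≤ tSub G ↔ E ≤ tSub G :=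
  ⟨(le_tSub E).trans, fun h => (tSub_mono h).trans (tSub_tSub G).le⟩

lemma tSub_le_one {E : Submodule D (FractionRing D)} (h : E ≤ 1) : tSub E ≤ 1 := by
  refine sSup_le ?_
  rintro _ ⟨F, hF, rfl⟩
  exact vSub_le_one (hF.2.2.trans h)

lemma tSub_mul_tSub_le (E G : Submodule D (FractionRing D)) :
    tSub E * tSub G ≤ tSub (E * G) := by
  simp only [tSub, sSup_eq_iSup, Submodule.iSup_mul, Submodule.mul_iSup, iSup_le_iff]
  rintro _ ⟨B, hB, rfl⟩ _ ⟨A, hA, rfl⟩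
  refine (vSub_mul_vSub_le _ _).trans ?_
  rw [← sSup_eq_iSup]
  exact le_sSup ⟨_, ⟨hA.1.mul hB.1, mul_ne_zero hA.2.1 hB.2.1,
    mul_le_mul' hA.2.2 hB.2.2⟩, rfl⟩

lemma one_mem_tSub_sSup {c : Set (Submodule D (FractionRing D))} (hne : c.Nonempty)
    (hdir : DirectedOn (· ≤ ·) c) (h : 1 ∈ tSub (sSup c)) : ∃ E ∈ c, 1 ∈ tSub E := by
  have h0 : sSup c ≠ ⊥ := by
    intro h0
    rw [h0, tSub, show fgSubs (⊥ : Submodule D (FractionRing D)) = ∅ from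
      Set.eq_empty_of_forall_notMem fun F hF => hF.2.1 (le_bot_iff.1 hF.2.2)] at h
    simp at h
  obtain ⟨F, ⟨hF, hF0, hFc⟩, hx⟩ := (mem_tSub h0).1 h
  obtain ⟨E, hE, hFE⟩ := (CompleteLattice.isCompactElement_iff_le_of_directed_sSup_le
    _ F).1 ((Submodule.fg_iff_compact F).1 hF) _ hne hdir hFc
  exact ⟨E, hE, (le_sSup ⟨F, ⟨hF, hF0, hFE⟩, rfl⟩ : vSub D F ≤ tSub E) hx⟩

lemma coeI_le_one (I : Ideal D) : coeI D I ≤ 1 := by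
  rw [Submodule.one_eq_range, coeI]
  exact LinearMap.map_le_range

lemma coeI_comap {E : Submodule D (FractionRing D)} (h : E ≤ 1) :
    coeI D (E.comap (Algebra.linearMap D (FractionRing D))) = E := by
  rw [Submodule.one_eq_range] at h
  exact Submodule.map_comap_eq_self h

lemma coeI_ne_bot {I : Ideal D} (h : I ≠ ⊥) : coeI D I ≠ ⊥ := by
  obtain ⟨x, hx, hx0⟩ := Submodule.exists_mem_ne_zero_of_ne_bot h
  refine (Submodule.ne_bot_iff _).2 ⟨_, Submodule.mem_map_of_mem hx, ?_⟩
  simpa using hx0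

lemma coeI_mul (I J : Ideal D) : coeI D (I * J) = coeI D I * coeI D J :=
  Submodule.map_mul I J (Algebra.ofId D (FractionRing D))

lemma IsPvMD.one_mem_tSub_mul_one_div (h : IsPvMD D) {H : Submodule D (FractionRing D)}
    (hH : H ≤ 1) (h0 : H ≠ ⊥) (hfg : H.FG) : 1 ∈ tSub (H * (1 / H)) := by
  have hc := coeI_comap hH
  set J : Ideal D := H.comap (Algebra.linearMap D (FractionRing D))
  have hJ0 : J ≠ ⊥ := by
    intro hJ
    rw [hJ] at hc
    exact h0 (hc.symm.trans (by simp [coeI]))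
  have hJfg : J.FG := Submodule.fg_of_fg_map_injective (Algebra.linearMap D (FractionRing D))
    (FaithfulSMul.algebraMap_injective D (FractionRing D)) (by rw [← coeI, hc]; exact hfg)
  have hinv := h J hJ0 hJfg
  rw [hc] at hinv
  have h1 : (1 : Submodule D (FractionRing D)) ≤ 1 / H := le_one_div_iff.2 (by rwa [one_mul])
  have hne : H * (1 / H) ≠ ⊥ := mul_ne_zero h0 fun h2 => by
    rw [h2] at h1
    exact one_ne_zero (le_bot_iff.1 h1)
  rw [← SetLike.mem_coe, coe_tSub hne, hinv]
  exact Submodule.one_le.1 le_rfl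

/-- In a PvMD, the colon of a `t`-idempotent `t`-ideal by an element is `t`-idempotent. -/
lemma IsPvMD.colonOne_le_tSub_mul_self (h : IsPvMD D) {E : Submodule D (FractionRing D)}
    (hE1 : E ≤ 1) (hE0 : E ≠ ⊥) (hidem : E ≤ tSub (E * E)) {α : FractionRing D}
    (hα : α ∈ (1 : Submodule D (FractionRing D))) (hα0 : α ≠ 0) :
    colonOne E α ≤ tSub (colonOne E α * colonOne E α) := by
  intro x hx
  set C := colonOne E α
  obtain ⟨F, hF, hxF⟩ := (mem_tSub (mul_ne_zero hE0 hE0)).1 (hidem hx.2)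
  obtain ⟨G, hG, hGE, hFG⟩ := exists_fg_le_mul_self_s15 hF.1 hF.2.2
  have hxG : (D ∙ (α * x)) ≤ tSub (G * G) := by
    rw [Submodule.span_singleton_le_iff_mem]
    exact (le_sSup ⟨F, ⟨hF.1, hF.2.1, hFG⟩, rfl⟩ : vSub D F ≤ tSub (G * G)) hxF
  set H := G ⊔ D ∙ α with hH
  have hH1 : H ≤ 1 := sup_le (hGE.trans hE1) (by simpa using hα)
  have hH0 : H ≠ ⊥ := fun h0 => hα0 (by simpa using (sup_eq_bot_iff.1 h0).2)
  have hinv := h.one_mem_tSub_mul_one_div hH1 hH0 (hG.sup (Submodule.fg_span_singleton α))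
  set N := 1 / H
  have hHN : H * N ≤ 1 := by
    rw [mul_comm]
    exact le_one_div_iff.1 le_rfl
  set A := G * N
  set B := (D ∙ α) * N
  have hAB : H * N = A ⊔ B := Submodule.sup_mul _ _ _
  rw [hAB] at hHN hinv
  have hA1 : A ≤ 1 := le_sup_left.trans hHN
  have hB1 : B ≤ 1 := le_sup_right.trans hHN
  have hAC : A ≤ C := by
    refine fun y hy => ⟨hA1 hy, ?_⟩
    have h1 : (D ∙ α) * A ≤ E := calc
      (D ∙ α) * A = G * B := mul_left_comm _ _ _
      _ ≤ E * 1 := mul_le_mul' hGE hB1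
      _ = E := mul_one E
    exact h1 (Submodule.mul_mem_mul (Submodule.mem_span_singleton_self α) hy)
  have hone : (1 : Submodule D (FractionRing D)) ≤ tSub (A ⊔ B * B) := by
    have h1 : (1 : Submodule D (FractionRing D)) ≤ tSub (A ⊔ B) := Submodule.one_le.2 hinv
    calc (1 : Submodule D (FractionRing D)) = 1 * 1 := (one_mul 1).symm
      _ ≤ tSub (A ⊔ B) * tSub (A ⊔ B) := mul_le_mul' h1 h1
      _ ≤ tSub ((A ⊔ B) * (A ⊔ B)) := tSub_mul_tSub_le _ _
      _ ≤ tSub (A ⊔ B * B) := tSub_mono ?_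
    have hA (X : Submodule D (FractionRing D)) (hX : X ≤ 1) : A * X ≤ A :=
      (mul_le_mul' le_rfl hX).trans (mul_one A).le
    rw [Submodule.sup_mul, Submodule.mul_sup B]
    refine sup_le ((hA _ hHN).trans le_sup_left) (sup_le ?_ le_sup_right)
    rw [mul_comm B A]
    exact (hA _ hB1).trans le_sup_left
  have hxA : (D ∙ x) * A ≤ tSub (C * C) :=
    (mul_le_mul' (by simpa using hx) hAC).trans (le_tSub _)
  have hxB : (D ∙ x) * (B * B) ≤ tSub (C * C) := calc
    (D ∙ x) * (B * B) = (D ∙ α) * ((D ∙ (α * x)) * (N * N)) := by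
      rw [← Set.singleton_mul_singleton, ← Submodule.span_mul_span]
      ring
    _ ≤ 1 * (tSub (G * G) * tSub (N * N)) :=
      mul_le_mul' (by simpa using hα) (mul_le_mul' hxG (le_tSub _))
    _ ≤ tSub (G * G * (N * N)) := by
      rw [one_mul]
      exact tSub_mul_tSub_le _ _
    _ = tSub (A * A) := by rw [mul_mul_mul_comm]
    _ ≤ tSub (C * C) := tSub_mono (mul_le_mul' hAC hAC)
  have : (D ∙ x) ≤ tSub (C * C) := calc
    (D ∙ x) = (D ∙ x) * 1 := (mul_one _).symm
    _ ≤ tSub (D ∙ x) * tSub (A ⊔ B * B) := mul_le_mul' (le_tSub _) hone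
    _ ≤ tSub ((D ∙ x) * (A ⊔ B * B)) := tSub_mul_tSub_le _ _
    _ ≤ tSub (C * C) := tSub_le_iff.2 (by rw [Submodule.mul_sup]; exact sup_le hxA hxB)
  simpa using this

/-- A maximal proper `t`-idempotent submodule of `D` above a given one. -/
lemma exists_maximal_idem {E : Submodule D (FractionRing D)} (hE1 : E ≤ 1)
    (hidem : E ≤ tSub (E * E)) (hE : 1 ∉ tSub E) :
    ∃ P, E ≤ P ∧ Maximal (fun P : Submodule D (FractionRing D) =>
      P ≤ 1 ∧ P ≤ tSub (P * P) ∧ 1 ∉ tSub P) P := by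
  refine zorn_le_nonempty₀ {P : Submodule D (FractionRing D) |
    P ≤ 1 ∧ P ≤ tSub (P * P) ∧ 1 ∉ tSub P} ?_ E ⟨hE1, hidem, hE⟩
  intro c hc hchain Q hQ
  refine ⟨sSup c, ⟨sSup_le fun X hX => (hc hX).1, sSup_le fun X hX => ?_, fun h => ?_⟩,
    fun X hX => le_sSup hX⟩
  · exact (hc hX).2.1.trans (tSub_mono (mul_le_mul' (le_sSup hX) (le_sSup hX)))
  · obtain ⟨X, hX, h1⟩ := one_mem_tSub_sSup ⟨Q, hQ⟩ hchain.directedOn h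
    exact (hc hX).2.2 h1

end TClosure

theorem statement15 (D : Type*) [CommRing D] [IsDomain D]
    (hPvMD : IsPvMD D)
    (hsd : ∀ P : Ideal D, P.IsPrime → P ≠ ⊥ → IsTIdeal D P → ¬ TIdem D P)
    (I : Ideal D) (hI0 : I ≠ ⊥) (hidem : TIdem D I) :
    tSet D (coeI D I) = ((1 : Submodule D (FractionRing D)) : Set (FractionRing D)) := by
  have hK0 := coeI_ne_bot hI0
  have hidem' : coeI D I ≤ tSub (coeI D I * coeI D I) := by
    rw [TIdem, coeI_mul, ← coe_tSub hK0, ← coe_tSub (mul_ne_zero hK0 hK0),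
      SetLike.coe_set_eq] at hidem
    exact (le_tSub _).trans hidem.ge
  by_cases h1 : 1 ∈ tSub (coeI D I)
  · rw [← coe_tSub hK0, SetLike.coe_set_eq]
    exact le_antisymm (tSub_le_one (coeI_le_one I)) (Submodule.one_le.2 h1)
  exfalso
  obtain ⟨P, hIP, hP⟩ := exists_maximal_idem (coeI_le_one I) hidem' h1
  obtain ⟨hP1, hPidem, hPone⟩ := hP.prop
  have hP0 : P ≠ ⊥ := ne_bot_of_le_ne_bot hK0 hIP
  have hPt : tSub P = P := by
    refine le_antisymm (hP.le_of_ge ⟨tSub_le_one hP1, ?_, by rwa [tSub_tSub]⟩ (le_tSub P))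
      (le_tSub P)
    exact tSub_le_iff.2 (hPidem.trans (tSub_mono (mul_le_mul' (le_tSub P) (le_tSub P))))
  have hmul {α β : FractionRing D} (hα : α ∈ (1 : Submodule D (FractionRing D)))
      (hβ : β ∈ (1 : Submodule D (FractionRing D))) (hαβ : α * β ∈ P) (hαP : α ∉ P) : β ∈ P := by
    have hα0 : α ≠ 0 := fun h => hαP (h ▸ zero_mem P)
    refine hP.le_of_ge ⟨inf_le_left, hPvMD.colonOne_le_tSub_mul_self hP1 hP0 hPidem hα hα0, ?_⟩
      (fun x hx => ⟨hP1 hx, mul_mem_of_mem_one hα hx⟩) (mem_colonOne.2 ⟨hβ, hαβ⟩)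
    intro h
    refine hαP ?_
    rw [← hPt, ← mul_one α]
    have hle : (D ∙ α) * colonOne P α ≤ P := by
      refine Submodule.mul_le.2 fun y hy z hz => ?_
      obtain ⟨d, rfl⟩ := Submodule.mem_span_singleton.1 hy
      rw [smul_mul_assoc]
      exact P.smul_mem d hz.2
    exact tSub_mono hle (tSub_mul_tSub_le _ _ (Submodule.mul_mem_mul
      (le_tSub _ (Submodule.mem_span_singleton_self α)) h))
  have hc := coeI_comap hP1
  set J : Ideal D := P.comap (Algebra.linearMap D (FractionRing D)) with hJ
  have hmem (d : D) : algebraMap D (FractionRing D) d ∈ (1 : Submodule D (FractionRing D)) :=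
    Submodule.algebraMap_mem d
  have hprime : J.IsPrime := by
    refine ⟨fun h => hPone ?_, fun {a b} hab => ?_⟩
    · have : (1 : D) ∈ J := h ▸ Submodule.mem_top
      exact le_tSub P (by simpa [hJ] using this)
    · refine or_iff_not_imp_left.2 fun ha => hmul (hmem a) (hmem b) ?_ ha
      simpa [hJ] using hab
  refine hsd J hprime ?_ ?_ ?_
  · intro h
    rw [h] at hc
    exact hP0 (hc.symm.trans (by simp [coeI]))
  · rw [IsTIdeal, hc, ← coe_tSub hP0, hPt]
  · rw [TIdem, coeI_mul, hc, ← coe_tSub hP0, ← coe_tSub (mul_ne_zero hP0 hP0),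
      SetLike.coe_set_eq]
    refine le_antisymm (tSub_mono ?_) (tSub_le_iff.2 hPidem)
    exact (mul_le_mul' le_rfl hP1).trans (mul_one P).le

end
end
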